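/- Let G be a connected finite simple graph and S ⊆ V(G). Then either all vertices of S can be covered by a single path of G, or there exists a path P of G such that α_G(S − V(P)) ≤ α_G(S) − κ_G(S) − 1. -/

import Mathlib

open SimpleGraph Set

variable {V : Type*}

/-- The independence number of `S` in `G`: the maximum cardinality of a subset of `S`
that is independent in `G`. -/
noncomputable def indepNumOn (G : SimpleGraph V) (S : Set V) : ℕ :=
  sSup {n | ∃ I : Set V, I ⊆ S ∧ I.Pairwise (fun a b => ¬ G.Adj a b) ∧ I.ncard = n}

/-- `I` is a maximum independent subset of `S` in `G`. -/
def MaxIndepOn (G : SimpleGraph V) (S : Set V) (I : Set V) : Prop :=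
  I ⊆ S ∧ I.Pairwise (fun a b => ¬ G.Adj a b) ∧ I.ncard = indepNumOn G S

/-- Two `x`–`y` walks are internally disjoint if they share only `x` and `y`. -/
def InternallyDisjoint (G : SimpleGraph V) {x y : V} (p q : G.Walk x y) : Prop :=
  ∀ v, v ∈ p.support → v ∈ q.support → v = x ∨ v = y

/-- Local connectivity `κ_G(x,y)`: maximum number of pairwise internally disjoint
`x`–`y` paths in `G`. -/
noncomputable def localConn (G : SimpleGraph V) (x y : V) : ℕ :=
  sSup {n | ∃ P : Set (G.Path x y),
    P.Pairwise (fun p q => InternallyDisjoint G p.1 q.1) ∧ P.ncard = n}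

/-- `κ_G(S)`: the minimum of local connectivities over distinct pairs in `S`,
`+∞` if `S` has at most one element. -/
noncomputable def setConn (G : SimpleGraph V) (S : Set V) : ℕ∞ :=
  ⨅ x ∈ S, ⨅ y ∈ S, ⨅ _ : x ≠ y, (localConn G x y : ℕ∞)

/-- Vertex connectivity `κ(G)`: the maximum `k` such that `G` has more than `k`
vertices and removing fewer than `k` vertices always leaves a connected graph. -/
noncomputable def vertexConn (G : SimpleGraph V) [Fintype V] : ℕ :=
  sSup {k | k < Fintype.card V ∧ ∀ X : Finset V, X.card < k →
    (G.induce ((↑X : Set V)ᶜ)).Connected}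

/-- The set of leaves (vertices of degree one) of a subgraph. -/
def subLeaves {G : SimpleGraph V} (T : G.Subgraph) : Set V :=
  {v | v ∈ T.verts ∧ (T.neighborSet v).ncard = 1}

/-- The set of branch vertices (vertices of degree at least three) of a subgraph. -/
def subBranches {G : SimpleGraph V} (T : G.Subgraph) : Set V :=
  {v | v ∈ T.verts ∧ 3 ≤ (T.neighborSet v).ncard}

namespace SimpleGraph

/-- Every walk from `A` to `B` meets `X`. -/
def Separates (G : SimpleGraph V) (A B X : Set V) : Prop :=
  ∀ a ∈ A, ∀ b ∈ B, ∀ p : G.Walk a b, ∃ v ∈ p.support, v ∈ X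

/-- There are `k` pairwise disjoint paths from `A` to `B`. -/
def HasLinkage (G : SimpleGraph V) (A B : Set V) (k : ℕ) : Prop :=
  ∃ (a b : Fin k → V) (p : ∀ i, G.Walk (a i) (b i)),
    (∀ i, a i ∈ A ∧ b i ∈ B ∧ (p i).IsPath) ∧
    ∀ i j v, v ∈ (p i).support → v ∈ (p j).support → i = j

/-- The vertex `v` can be reached from `A` by a walk avoiding `X`. -/
def ReachAvoiding (G : SimpleGraph V) (A X : Set V) (v : V) : Prop :=
  ∃ a ∈ A, ∃ p : G.Walk a v, ∀ z ∈ p.support, z ∉ X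

variable {G H : SimpleGraph V} {A B X Y : Set V} {x y : V}

lemma Separates.symm (h : G.Separates A B X) : G.Separates B A X := by
  intro b hb a ha p
  simpa using h a ha b hb p.reverse

lemma Separates.not_reachAvoiding (h : G.Separates A B X) {v : V}
    (h₁ : G.ReachAvoiding A X v) (h₂ : G.ReachAvoiding B X v) : False := by
  obtain ⟨a, ha, p, hp⟩ := h₁
  obtain ⟨b, hb, q, hq⟩ := h₂
  obtain ⟨v, hv, hvX⟩ := h a ha b hb (p.append q.reverse)
  rw [Walk.mem_support_append_iff, Walk.support_reverse, List.mem_reverse] at hv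
  exact hv.elim (fun h => hp v h hvX) (fun h => hq v h hvX)

lemma Walk.exists_walk_to_first_hit {u v : V} (p : G.Walk u v) (T : Set V)
    (hT : ∃ z ∈ p.support, z ∈ T) :
    ∃ w ∈ T, ∃ q : G.Walk u w, q.support ⊆ p.support ∧ ∀ z ∈ q.support, z ∈ T → z = w := by
  induction p with
  | nil =>
    obtain ⟨z, hz, hzT⟩ := hT
    simp only [Walk.support_nil, List.mem_singleton] at hz
    subst hz
    exact ⟨z, hzT, Walk.nil, by simp, by simp⟩
  | @cons u u' v hadj p ih =>
    by_cases hu : u ∈ T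
    · exact ⟨u, hu, Walk.nil, by simp, by simp⟩
    · obtain ⟨z, hz, hzT⟩ := hT
      rw [Walk.support_cons, List.mem_cons] at hz
      obtain rfl | hz := hz
      · exact absurd hzT hu
      · obtain ⟨w, hw, q, hq, hqT⟩ := ih ⟨z, hz, hzT⟩
        refine ⟨w, hw, Walk.cons hadj q, ?_, ?_⟩
        · rw [Walk.support_cons, Walk.support_cons]
          exact List.cons_subset_cons _ hq
        · intro t ht htT
          rw [Walk.support_cons, List.mem_cons] at ht
          obtain rfl | ht := ht
          · exact absurd htT hu
          · exact hqT t ht htT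

lemma Walk.exists_deleteEdges_walk {u v : V} (p : G.Walk u v)
    (h : ¬ (x ∈ p.support ∧ y ∈ p.support)) :
    ∃ q : (G.deleteEdges {s(x, y)}).Walk u v, q.support = p.support := by
  refine ⟨p.transfer _ ?_, Walk.support_transfer _ _⟩
  intro e he
  rw [edgeSet_deleteEdges]
  refine ⟨p.edges_subset_edgeSet he, ?_⟩
  rintro rfl
  exact h ⟨p.fst_mem_support_of_mem_edges he, p.snd_mem_support_of_mem_edges he⟩

lemma Separates.insert_of_deleteEdges (h : (G.deleteEdges {s(x, y)}).Separates A B X) :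
    G.Separates A B (insert x X) := by
  intro a ha b hb p
  by_cases hx : x ∈ p.support
  · exact ⟨x, hx, mem_insert _ _⟩
  · obtain ⟨q, hq⟩ := p.exists_deleteEdges_walk (x := x) (y := y) (fun h => hx h.1)
    obtain ⟨v, hv, hvX⟩ := h a ha b hb q
    exact ⟨v, hq ▸ hv, mem_insert_of_mem _ hvX⟩

lemma Separates.of_separates_insert (hX : (G.deleteEdges {s(x, y)}).Separates A B X)
    (hxy : x ≠ y) (hyX : y ∉ X) (hy : ¬ (G.deleteEdges {s(x, y)}).ReachAvoiding A X y)
    (hY : (G.deleteEdges {s(x, y)}).Separates A (insert x X) Y) : G.Separates A B Y := by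
  intro a ha b hb p
  obtain ⟨z, hz, hzX⟩ := hX.insert_of_deleteEdges a ha b hb p
  obtain ⟨w, hw, q, hqp, hq⟩ := p.exists_walk_to_first_hit (insert y (insert x X))
    ⟨z, hz, mem_insert_of_mem _ hzX⟩
  obtain ⟨r, hr⟩ := q.exists_deleteEdges_walk (x := x) (y := y) (by
    rintro ⟨h₁, h₂⟩
    exact hxy ((hq x h₁ (by simp)).trans (hq y h₂ (by simp)).symm))
  obtain rfl | hw := hw
  · refine absurd ⟨a, ha, r, fun t ht htX => ?_⟩ hy
    have := hq t (hr ▸ ht) (by simp [htX])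
    exact hyX (this ▸ htX)
  · obtain ⟨v, hv, hvY⟩ := hY a ha w hw r
    exact ⟨v, hqp (hr ▸ hv), hvY⟩

lemma HasLinkage.mono (h : H ≤ G) {k : ℕ} (hk : H.HasLinkage A B k) : G.HasLinkage A B k := by
  obtain ⟨a, b, p, hp, hd⟩ := hk
  refine ⟨a, b, fun i => (p i).mapLe h, fun i => ⟨(hp i).1, (hp i).2.1, ?_⟩, ?_⟩
  · exact (Walk.isPath_mapLe h).2 (hp i).2.2
  · intro i j v
    simpa using hd i j v

/-- Two linkages of full size into the sides of an edge `xy`, together with a separator. -/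
lemma HasLinkage.trans_insert {k : ℕ} [Finite V] (hle : H ≤ G) (hxy : G.Adj x y)
    (hX : H.Separates A B X) (hyX : y ∉ X)
    (hk : (insert x X).ncard = k) (hk' : (insert y X).ncard = k)
    (h₁ : H.HasLinkage A (insert x X) k) (h₂ : H.HasLinkage B (insert y X) k) :
    G.HasLinkage A B k := by
  obtain ⟨a, u, p, hp, hpd⟩ := h₁
  obtain ⟨b, w, q, hq, hqd⟩ := h₂
  have surj : ∀ (Z : Set V) (f : Fin k → V), Z.ncard = k → (∀ i, f i ∈ Z) →
      Function.Injective f → ∀ z ∈ Z, ∃ i, f i = z := by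
    intro Z f hZ hf hinj z hz
    have : range f = Z := by
      apply Set.eq_of_subset_of_ncard_le (by rintro _ ⟨i, rfl⟩; exact hf i)
      rw [hZ, ← Set.image_univ, Set.ncard_image_of_injective _ hinj]
      simp
    rw [← this] at hz
    exact hz
  have su := surj _ u hk (fun i => (hp i).2.1) (fun i j h => hpd i j (u i) (by simp) (by simp [h]))
  have sw := surj _ w hk' (fun i => (hq i).2.1) (fun i j h => hqd i j (w i) (by simp) (by simp [h]))
  have endp : ∀ i, ∀ z ∈ (p i).support, z ∈ insert x X → z = u i := by
    intro i z hz hzX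
    obtain ⟨j, rfl⟩ := su z hzX
    rw [hpd i j _ hz (by simp)]
  have endq : ∀ i, ∀ z ∈ (q i).support, z ∈ insert y X → z = w i := by
    intro i z hz hzX
    obtain ⟨j, rfl⟩ := sw z hzX
    rw [hqd i j _ hz (by simp)]
  have reachp : ∀ i, ∀ z ∈ (p i).support, z ∉ X → H.ReachAvoiding A X z := by
    classical
    intro i z hz hzX
    refine ⟨a i, (hp i).1, (p i).takeUntil z hz, fun t ht htX => ?_⟩
    have htu := endp i t ((p i).support_takeUntil_subset_support hz ht) (by simp [htX])
    subst htu
    exact Walk.endpoint_notMem_support_takeUntil (hp i).2.2 hz (fun h => hzX (h ▸ htX)) ht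
  have reachq : ∀ i, ∀ z ∈ (q i).support, z ∉ X → H.ReachAvoiding B X z := by
    classical
    intro i z hz hzX
    refine ⟨b i, (hq i).1, (q i).takeUntil z hz, fun t ht htX => ?_⟩
    have htu := endq i t ((q i).support_takeUntil_subset_support hz ht) (by simp [htX])
    subst htu
    exact Walk.endpoint_notMem_support_takeUntil (hq i).2.2 hz (fun h => hzX (h ▸ htX)) ht
  have meet : ∀ i j z, z ∈ (p i).support → z ∈ (q j).support → z ∈ X := by
    intro i j z h₁ h₂
    by_contra hz
    exact hX.not_reachAvoiding (reachp i z h₁ hz) (reachq j z h₂ hz)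
  have match_exists : ∀ i, ∃ j, (u i = x ∧ w j = y) ∨ (u i ∈ X ∧ w j = u i) := by
    intro i
    rcases (hp i).2.1 with h | h
    · obtain ⟨j, hj⟩ := sw y (by simp)
      exact ⟨j, Or.inl ⟨h, hj⟩⟩
    · obtain ⟨j, hj⟩ := sw (u i) (by simp [h])
      exact ⟨j, Or.inr ⟨h, hj⟩⟩
  choose σ hσ using match_exists
  have hσinj : Function.Injective σ := by
    intro i j hij
    apply hpd i j (u i) (by simp)
    have : u i = u j := by
      rcases hσ i with ⟨h1, h2⟩ | ⟨h1, h2⟩ <;> rcases hσ j with ⟨h3, h4⟩ | ⟨h3, h4⟩ <;>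
        grind
    simp [this]
  have walks : ∀ i, ∃ r : G.Walk (a i) (b (σ i)), r.IsPath ∧
      ∀ z ∈ r.support, z ∈ (p i).support ∨ z ∈ (q (σ i)).support := by
    classical
    intro i
    suffices h : ∃ r : G.Walk (a i) (b (σ i)),
        ∀ z ∈ r.support, z ∈ (p i).support ∨ z ∈ (q (σ i)).support by
      obtain ⟨r, hr⟩ := h
      exact ⟨r.bypass, r.bypass_isPath, fun z hz => hr z (r.support_bypass_subset_support hz)⟩
    rcases hσ i with ⟨h1, h2⟩ | ⟨h1, h2⟩
    · have hadj : G.Adj (u i) (w (σ i)) := by rw [h1, h2]; exact hxy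
      refine ⟨((p i).mapLe hle).append (Walk.cons hadj ((q (σ i)).mapLe hle).reverse), ?_⟩
      intro z hz
      rw [Walk.mem_support_append_iff, Walk.support_cons, List.mem_cons] at hz
      rcases hz with hz | rfl | hz
      · exact Or.inl (by simpa using hz)
      · exact Or.inl (by simp)
      · exact Or.inr (by simpa using hz)
    · refine ⟨((p i).mapLe hle).append ((((q (σ i)).mapLe hle).reverse).copy h2 rfl), ?_⟩
      intro z hz
      rw [Walk.mem_support_append_iff] at hz
      simpa using hz
  choose r hr hrs using walks
  refine ⟨a, fun i => b (σ i), r, fun i => ⟨(hp i).1, (hq _).1, hr i⟩, ?_⟩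
  have cross : ∀ i j v, v ∈ (p i).support → v ∈ (q (σ j)).support → i = j := by
    intro i j v h₁ h₂
    have hv := meet _ _ _ h₁ h₂
    have e₁ := endp _ _ h₁ (by simp [hv])
    have e₂ := endq _ _ h₂ (by simp [hv])
    apply hpd i j (u i) (by simp)
    have : u i = u j := by
      rcases hσ j with ⟨h3, h4⟩ | ⟨h3, h4⟩ <;> grind
    simp [this]
  intro i j v hi hj
  rcases hrs i v hi with h₁ | h₁ <;> rcases hrs j v hj with h₂ | h₂
  · exact hpd _ _ _ h₁ h₂
  · exact cross _ _ _ h₁ h₂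
  · exact (cross _ _ _ h₂ h₁).symm
  · exact hσinj (hqd _ _ _ h₁ h₂)

/-- **Menger's theorem**, vertex version between two sets. -/
theorem hasLinkage_of_forall_separates [Finite V] (G : SimpleGraph V) (k : ℕ) (A B : Set V)
    (h : ∀ X, G.Separates A B X → k ≤ X.ncard) : G.HasLinkage A B k := by
  induction G using WellFoundedLT.induction generalizing A B with
  | ind G ih =>
  by_cases hG : ∃ x y, G.Adj x y
  swap
  · push Not at hG
    have hsep : G.Separates A B (A ∩ B) := by
      intro a ha b hb p
      cases p with
      | nil => exact ⟨a, by simp, ha, hb⟩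
      | cons hadj _ => exact absurd hadj (hG _ _)
    obtain ⟨f, hf⟩ : ∃ f : Fin k → V, Function.Injective f ∧ ∀ i, f i ∈ A ∩ B := by
      obtain ⟨Z, hZ, hZk⟩ := Set.exists_subset_card_eq (h _ hsep)
      have e : Z ≃ Fin k := Finite.equivFinOfCardEq (by simpa [Set.ncard] using hZk)
      exact ⟨fun i => (e.symm i).1, Subtype.val_injective.comp e.symm.injective,
        fun i => hZ (e.symm i).2⟩
    refine ⟨f, f, fun i => Walk.nil, fun i => ⟨(hf.2 i).1, (hf.2 i).2, by simp⟩, ?_⟩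
    intro i j v hi hj
    simp only [Walk.support_nil, List.mem_singleton] at hi hj
    exact hf.1 (hi.symm.trans hj)
  obtain ⟨x₀, y₀, hadj₀⟩ := hG
  have hlt : ∀ x y, G.Adj x y → G.deleteEdges {s(x, y)} < G := by
    intro x y hadj
    refine lt_of_le_of_ne (deleteEdges_le _) fun heq => ?_
    rw [← heq] at hadj
    simp at hadj
  by_cases hall : ∀ X, (G.deleteEdges {s(x₀, y₀)}).Separates A B X → k ≤ X.ncard
  · exact (ih _ (hlt _ _ hadj₀) A B hall).mono (deleteEdges_le _)
  push Not at hall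
  obtain ⟨X, hX, hXk⟩ := hall
  have hnot : ¬ G.Separates A B X := fun hs => absurd (h X hs) (by omega)
  simp only [Separates] at hnot
  push Not at hnot
  obtain ⟨a, ha, b, hb, p, hp⟩ := hnot
  obtain ⟨d, hd, hd₁, hd₂⟩ := p.exists_boundary_dart
    {v | (G.deleteEdges {s(x₀, y₀)}).ReachAvoiding A X v}
    ⟨a, ha, Walk.nil, by simpa using hp a (by simp)⟩
    (fun hbA => hX.not_reachAvoiding hbA ⟨b, hb, Walk.nil, by simpa using hp b (by simp)⟩)
  have hdX : d.snd ∉ X := hp _ (p.dart_snd_mem_support_of_mem_darts hd)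
  have hde : s(x₀, y₀) = s(d.fst, d.snd) := by
    by_contra hne
    apply hd₂
    obtain ⟨a', ha', q, hq⟩ := hd₁
    have hadj' : (G.deleteEdges {s(x₀, y₀)}).Adj d.fst d.snd := by
      rw [deleteEdges_adj]
      exact ⟨d.adj, fun he => hne (by simpa [eq_comm] using he)⟩
    refine ⟨a', ha', q.concat hadj', ?_⟩
    · intro z hz
      rw [Walk.support_concat, List.mem_append, List.mem_singleton] at hz
      rcases hz with hz | rfl
      · exact hq z hz
      · exact hdX
  rw [hde] at hX hd₁ hd₂
  have hadj := d.adj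
  have hxX : d.fst ∉ X := hp _ (p.dart_fst_mem_support_of_mem_darts hd)
  generalize d.fst = x at *
  generalize d.snd = y at *
  have hX' : (G.deleteEdges {s(y, x)}).Separates B A X := by
    rw [Sym2.eq_swap]; exact hX.symm
  have hcx : (insert x X).ncard = k := by
    have := h _ hX.insert_of_deleteEdges
    rw [Set.ncard_insert_of_notMem hxX] at this ⊢
    omega
  have hcy : (insert y X).ncard = k := by
    rw [Set.ncard_insert_of_notMem hxX] at hcx
    rw [Set.ncard_insert_of_notMem hdX, hcx]
  refine HasLinkage.trans_insert (deleteEdges_le {s(x, y)}) hadj hX hdX hcx hcy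
    (ih _ (hlt _ _ hadj) A _ fun Y hY => h _ (hX.of_separates_insert hadj.ne hdX hd₂ hY))
    (ih _ (hlt _ _ hadj) B _ fun Y hY => h _ ?_)
  refine (hX'.of_separates_insert hadj.ne' hxX ?_ ?_).symm
  · rw [Sym2.eq_swap]
    exact fun hx => hX.not_reachAvoiding hd₁ hx
  · rwa [Sym2.eq_swap]

end SimpleGraph

section IndepNumOn

variable [Finite V] {G : SimpleGraph V} {S T W X Y P : Set V}

lemma bddAbove_indepNumOn (G : SimpleGraph V) (S : Set V) : BddAbove
    {n | ∃ I : Set V, I ⊆ S ∧ I.Pairwise (fun a b => ¬ G.Adj a b) ∧ I.ncard = n} :=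
  ⟨Nat.card V, by rintro _ ⟨I, -, -, rfl⟩; exact Set.ncard_le_card I⟩

lemma exists_maxIndepOn (G : SimpleGraph V) (S : Set V) : ∃ I, MaxIndepOn G S I := by
  refine Nat.sSup_mem ?_ (bddAbove_indepNumOn G S)
  exact ⟨0, ∅, by simp, by simp, by simp⟩

lemma ncard_le_indepNumOn {I : Set V} (hI : I ⊆ S) (h : I.Pairwise (fun a b => ¬ G.Adj a b)) :
    I.ncard ≤ indepNumOn G S :=
  le_csSup (bddAbove_indepNumOn G S) ⟨I, hI, h, rfl⟩

lemma indepNumOn_mono (h : S ⊆ T) : indepNumOn G S ≤ indepNumOn G T := by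
  obtain ⟨I, hI, hI', hIc⟩ := exists_maxIndepOn G S
  rw [← hIc]
  exact ncard_le_indepNumOn (hI.trans h) hI'

lemma indepNumOn_empty : indepNumOn G ∅ = 0 := by
  obtain ⟨I, hI, -, hIc⟩ := exists_maxIndepOn G ∅
  rw [← hIc, Set.subset_empty_iff.1 hI, Set.ncard_empty]

lemma eq_empty_of_indepNumOn_eq_zero (h : indepNumOn G S = 0) : S = ∅ := by
  by_contra hne
  obtain ⟨v, hv⟩ := Set.nonempty_iff_ne_empty.2 hne
  have := ncard_le_indepNumOn (G := G) (Set.singleton_subset_iff.2 hv) (by simp)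
  simp [h] at this

lemma indepNumOn_insert_le (v : V) : indepNumOn G (insert v S) ≤ indepNumOn G S + 1 := by
  obtain ⟨I, hI, hI', hIc⟩ := exists_maxIndepOn G (insert v S)
  have h₁ : (I \ {v}).ncard ≤ indepNumOn G S :=
    ncard_le_indepNumOn (by simpa [Set.sdiff_subset_iff] using hI) (hI'.mono Set.sdiff_subset)
  have h₂ := Set.pred_ncard_le_ncard_sdiff_singleton I v
  omega

lemma indepNumOn_union_of_forall_not_adj (h : Disjoint X Y) (hXY : ∀ u ∈ X, ∀ v ∈ Y, ¬ G.Adj u v) :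
    indepNumOn G (X ∪ Y) = indepNumOn G X + indepNumOn G Y := by
  apply le_antisymm
  · obtain ⟨I, hI, hI', hIc⟩ := exists_maxIndepOn G (X ∪ Y)
    have h₁ : (I ∩ X).ncard ≤ indepNumOn G X :=
      ncard_le_indepNumOn Set.inter_subset_right (hI'.mono Set.inter_subset_left)
    have h₂ : (I ∩ Y).ncard ≤ indepNumOn G Y :=
      ncard_le_indepNumOn Set.inter_subset_right (hI'.mono Set.inter_subset_left)
    have h₃ := Set.ncard_union_le (I ∩ X) (I ∩ Y)
    rw [← Set.inter_union_distrib_left, Set.inter_eq_left.2 hI] at h₃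
    omega
  · obtain ⟨I, hI, hI', hIc⟩ := exists_maxIndepOn G X
    obtain ⟨J, hJ, hJ', hJc⟩ := exists_maxIndepOn G Y
    rw [← hIc, ← hJc, ← Set.ncard_union_eq (h.mono hI hJ)]
    refine ncard_le_indepNumOn (Set.union_subset_union hI hJ) ?_
    rintro u (hu | hu) v (hv | hv) huv
    · exact hI' hu hv huv
    · exact hXY u (hI hu) v (hJ hv)
    · exact fun hadj => hXY v (hI hv) u (hJ hu) hadj.symm
    · exact hJ' hu hv huv

/-- The graph obtained from `G` by deleting all edges that meet `P`. -/
def SimpleGraph.isolate (G : SimpleGraph V) (P : Set V) : SimpleGraph V where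
  Adj u v := G.Adj u v ∧ u ∉ P ∧ v ∉ P
  symm := ⟨fun _ _ h => ⟨h.1.symm, h.2.2, h.2.1⟩⟩
  loopless := ⟨fun _ h => h.1.ne rfl⟩

/-- There is a walk from `u` to `v` all of whose interior vertices are outside `P`. -/
def SimpleGraph.LinkedOff (G : SimpleGraph V) (P : Set V) (u v : V) : Prop :=
  G.Adj u v ∨ ∃ s t, s ∉ P ∧ t ∉ P ∧ G.Adj u s ∧ (G.isolate P).Reachable s t ∧ G.Adj t v

omit [Finite V] in
lemma SimpleGraph.LinkedOff.symm {u v : V} (h : G.LinkedOff P u v) : G.LinkedOff P v u := by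
  rcases h with h | ⟨s, t, hs, ht, hus, hst, htv⟩
  · exact Or.inl h.symm
  · exact Or.inr ⟨t, s, ht, hs, htv.symm, hst.symm, hus.symm⟩

omit [Finite V] in
lemma SimpleGraph.LinkedOff.trans_adj {u v w : V} (h : G.LinkedOff P u v) (hv : v ∉ P)
    (hvw : G.Adj v w) : G.LinkedOff P u w := by
  rcases h with h | ⟨s, t, hs, ht, hus, hst, htv⟩
  · exact Or.inr ⟨v, v, hv, hv, h, .refl _, hvw⟩
  · refine Or.inr ⟨s, v, hs, hv, hus, hst.trans ?_, hvw⟩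
    exact Adj.reachable (G := G.isolate P) ⟨htv, ht, hv⟩

lemma indepNumOn_union_add_of_not_linkedOff (hWP : Disjoint W P) (hWX : Disjoint W X)
    (hWY : Disjoint W Y) (hXY : Disjoint X Y) (h : ∀ u ∈ X, ∀ v ∈ Y, ¬ G.LinkedOff P u v) :
    indepNumOn G (W ∪ (X ∪ Y)) + indepNumOn G W =
      indepNumOn G (W ∪ X) + indepNumOn G (W ∪ Y) := by
  set W₁ : Set V := {w ∈ W | ∃ u ∈ X, G.LinkedOff P u w} with hW₁
  set W₂ : Set V := W \ W₁ with hW₂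
  have hsub : W₁ ⊆ W := fun _ hw => hw.1
  have hd : Disjoint W₁ W₂ := Set.disjoint_sdiff_right
  have hW : W₁ ∪ W₂ = W := Set.union_sdiff_cancel hsub
  have hdX : Disjoint X W₂ := (hWX.mono_left Set.sdiff_subset).symm
  have hdY : Disjoint W₁ Y := hWY.mono_left hsub
  have adj₁ : ∀ u ∈ X, ∀ v ∈ W₂, ¬ G.Adj u v := fun u hu v hv hadj =>
    hv.2 ⟨hv.1, u, hu, Or.inl hadj⟩
  have adj₂ : ∀ u ∈ W₁, ∀ v ∈ W₂, ¬ G.Adj u v := by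
    rintro w ⟨hw, u, hu, huw⟩ v hv hadj
    exact hv.2 ⟨hv.1, u, hu, huw.trans_adj (Set.disjoint_left.1 hWP hw) hadj⟩
  have adj₃ : ∀ u ∈ W₁, ∀ v ∈ Y, ¬ G.Adj u v := by
    rintro w ⟨hw, u, hu, huw⟩ v hv hadj
    exact h u hu v hv (huw.trans_adj (Set.disjoint_left.1 hWP hw) hadj)
  have adj₄ : ∀ u ∈ X, ∀ v ∈ Y, ¬ G.Adj u v := fun u hu v hv hadj => h u hu v hv (Or.inl hadj)
  have e₁ : W ∪ (X ∪ Y) = (X ∪ W₁) ∪ (W₂ ∪ Y) := by rw [← hW]; ac_rfl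
  have e₂ : W ∪ X = (X ∪ W₁) ∪ W₂ := by rw [← hW]; ac_rfl
  have e₃ : W ∪ Y = W₁ ∪ (W₂ ∪ Y) := by rw [← hW]; ac_rfl
  have f₁ : indepNumOn G ((X ∪ W₁) ∪ (W₂ ∪ Y)) = indepNumOn G (X ∪ W₁) + indepNumOn G (W₂ ∪ Y) := by
    apply indepNumOn_union_of_forall_not_adj
    · simp [hd, hdX, hdY, hXY]
    · rintro u (hu | hu) v (hv | hv)
      exacts [adj₁ u hu v hv, adj₄ u hu v hv, adj₂ u hu v hv, adj₃ u hu v hv]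
  have f₂ : indepNumOn G ((X ∪ W₁) ∪ W₂) = indepNumOn G (X ∪ W₁) + indepNumOn G W₂ := by
    apply indepNumOn_union_of_forall_not_adj
    · simp [hd, hdX]
    · rintro u (hu | hu) v hv
      exacts [adj₁ u hu v hv, adj₂ u hu v hv]
  have f₃ : indepNumOn G (W₁ ∪ (W₂ ∪ Y)) = indepNumOn G W₁ + indepNumOn G (W₂ ∪ Y) := by
    apply indepNumOn_union_of_forall_not_adj
    · simp [hd, hdY]
    · rintro u hu v (hv | hv)
      exacts [adj₂ u hu v hv, adj₃ u hu v hv]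
  have f₄ := indepNumOn_union_of_forall_not_adj (G := G) hd adj₂
  rw [hW] at f₄
  rw [e₁, e₂, e₃]
  omega

lemma add_card_le_indepNumOn_iUnion {ι : Type*} (J : Finset ι) (A : ι → Set V)
    (hWP : Disjoint W P) (hWA : ∀ i ∈ J, Disjoint W (A i))
    (hA : (J : Set ι).Pairwise fun i j => Disjoint (A i) (A j))
    (hlink : (J : Set ι).Pairwise fun i j => ∀ u ∈ A i, ∀ v ∈ A j, ¬ G.LinkedOff P u v)
    (hinc : ∀ i ∈ J, indepNumOn G W + 1 ≤ indepNumOn G (W ∪ A i)) :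
    indepNumOn G W + J.card ≤ indepNumOn G (W ∪ ⋃ i ∈ J, A i) := by
  classical
  induction J using Finset.induction_on with
  | empty => simp
  | insert j J hj ih =>
    have ih := ih (fun i hi => hWA i (by simp [hi])) (hA.mono (by simp)) (hlink.mono (by simp))
      (fun i hi => hinc i (by simp [hi]))
    have hne : ∀ i ∈ J, j ≠ i := fun i hi h => hj (h ▸ hi)
    have := indepNumOn_union_add_of_not_linkedOff (G := G) (X := A j) (Y := ⋃ i ∈ J, A i) hWP
      (hWA j (by simp))
      (by simp only [Set.disjoint_iUnion_right]; exact fun i hi => hWA i (by simp [hi]))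
      (by
        simp only [Set.disjoint_iUnion_right]
        exact fun i hi => hA (by simp) (by simp [hi]) (hne i hi))
      (by
        intro u hu v hv
        simp only [Set.mem_iUnion] at hv
        obtain ⟨i, hi, hv⟩ := hv
        exact hlink (by simp) (by simp [hi]) (hne i hi) u hu v hv)
    have h₁ := hinc j (by simp)
    rw [Finset.set_biUnion_insert, Finset.card_insert_of_notMem hj]
    omega

end IndepNumOn

section Segment

/-- The entries of `l` at the positions `i` with `a ≤ i < b`. -/
def List.segment (l : List V) (a b : ℕ) : List V := (l.take b).drop a

variable {G : SimpleGraph V} {l : List V} {a b c d : ℕ} {v : V}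

lemma List.mem_segment : v ∈ l.segment a b ↔ ∃ i, a ≤ i ∧ i < b ∧ l[i]? = some v := by
  rw [List.segment, List.mem_iff_getElem?]
  simp only [List.getElem?_drop, List.getElem?_take]
  constructor
  · rintro ⟨i, hi⟩
    split_ifs at hi with h
    exact ⟨a + i, by omega, h, hi⟩
  · rintro ⟨i, ha, hb, hi⟩
    obtain ⟨j, rfl⟩ := Nat.exists_eq_add_of_le ha
    exact ⟨j, by rw [if_pos hb, hi]⟩

lemma List.segment_sublist : (l.segment a b).Sublist l :=
  (List.drop_sublist _ _).trans (List.take_sublist _ _)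

lemma List.segment_subset : l.segment a b ⊆ l := List.segment_sublist.subset

lemma List.IsChain.segment (h : l.IsChain G.Adj) : (l.segment a b).IsChain G.Adj :=
  (h.take b).drop a

lemma List.Nodup.segment (h : l.Nodup) : (l.segment a b).Nodup := h.sublist List.segment_sublist

lemma List.Nodup.disjoint_segment (h : l.Nodup) (hbc : b ≤ c) :
    List.Disjoint (l.segment a b) (l.segment c d) := by
  intro v h₁ h₂
  obtain ⟨i, -, hib, hi⟩ := List.mem_segment.1 h₁
  obtain ⟨j, hcj, -, hj⟩ := List.mem_segment.1 h₂
  have hlt := (List.getElem?_eq_some_iff.1 hi).1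
  have := (List.getElem?_inj hlt h).1 (hi.trans hj.symm)
  omega

lemma List.mem_head?_segment (h : v ∈ (l.segment a b).head?) : l[a]? = some v := by
  rw [List.segment, List.head?_drop, List.getElem?_take] at h
  split_ifs at h with hab
  · exact h
  · simp at h

lemma List.mem_getLast?_segment (h : v ∈ (l.segment a b).getLast?) (hb : b ≤ l.length) :
    0 < b ∧ l[b - 1]? = some v := by
  have h' : l.segment a b ≠ [] := by rintro h'; simp [h'] at h
  have hab : a < b := by
    by_contra hab
    apply h'
    simp only [List.segment, List.drop_eq_nil_iff, List.length_take]
    omega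
  refine ⟨by omega, ?_⟩
  rw [List.segment, List.getLast?_drop, List.length_take, if_neg (by omega), List.getLast?_take,
    if_neg (by omega)] at h
  have hlt : b - 1 < l.length := by omega
  rw [List.getElem?_eq_getElem hlt] at h ⊢
  simpa using h

end Segment

namespace SimpleGraph

variable {G : SimpleGraph V} {l : List V} {x : V} {K : Finset ℕ} {F : ℕ → List V}

/-- A fan from `x` to the path `l`. Its feet are the entries of `l` just before the positions in
`K`, where the position `0` stands for a virtual foot, and `F s` is the interior of the path
from the foot of `s` to `x`. -/
structure IsFan (G : SimpleGraph V) (l : List V) (x : V) (K : Finset ℕ) (F : ℕ → List V) :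
    Prop where
  zero_mem : 0 ∈ K
  zero : F 0 = []
  le_length : ∀ s ∈ K, s ≤ l.length
  isChain : ∀ s ∈ K, (F s ++ [x]).IsChain G.Adj
  nodup : ∀ s ∈ K, (F s ++ [x]).Nodup
  notMem : ∀ s ∈ K, ∀ v ∈ F s, v ∉ l
  disjoint : ∀ s ∈ K, ∀ t ∈ K, s ≠ t → List.Disjoint (F s) (F t)
  adj : ∀ s ∈ K, 0 < s → ∀ u, l[s - 1]? = some u → ∀ v ∈ (F s ++ [x]).head?, G.Adj u v

/-- There is a path through `x` covering all of `l` except for vertices in `T`. -/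
def Reroutes (G : SimpleGraph V) (l : List V) (x : V) (T : Set V) : Prop :=
  ∃ l' : List V, l'.IsChain G.Adj ∧ l'.Nodup ∧ x ∈ l' ∧ ∀ v ∈ l, v ∉ l' → v ∈ T

lemma IsFan.reroutes_segment (hF : G.IsFan l x K F) (hl : l.IsChain G.Adj) (hln : l.Nodup)
    (hx : x ∉ l) {s p : ℕ} (hs : s ∈ K) (hsp : s ≤ p) {Z : List V}
    (hZ : (x :: Z).IsChain G.Adj) (hZn : (x :: Z).Nodup) (hZl : List.Disjoint Z l)
    (hZF : List.Disjoint Z (F s))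
    (hZp : ∀ y, l[p]? = some y → ∀ v ∈ (x :: Z).getLast?, G.Adj v y) :
    G.Reroutes l x {v | v ∈ l.segment s p} := by
  have hFn := hF.nodup s hs
  have hFl := hF.notMem s hs
  refine ⟨l.segment 0 s ++ (F s ++ (x :: (Z ++ l.segment p l.length))), ?_, ?_, by simp, ?_⟩
  · have h₁ : (x :: (Z ++ l.segment p l.length)).IsChain G.Adj := by
      rw [← List.cons_append]
      refine hZ.append hl.segment fun v hv y hy => ?_
      exact hZp y (List.mem_head?_segment hy) v hv
    have h₂ : (F s ++ (x :: (Z ++ l.segment p l.length))).IsChain G.Adj := by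
      have := hF.isChain s hs
      rw [List.isChain_append] at this
      exact this.1.append h₁ (by simpa using this.2.2)
    refine hl.segment.append h₂ fun u hu v hv => ?_
    obtain ⟨hs0, hu⟩ := List.mem_getLast?_segment hu (hF.le_length s hs)
    refine hF.adj s hs hs0 u hu v ?_
    rw [List.head?_append] at hv ⊢
    simpa using hv
  · have hd := hln.disjoint_segment (a := 0) (d := l.length) hsp
    have h₁ : (l.segment 0 s).Nodup := hln.segment
    have h₂ : (l.segment p l.length).Nodup := hln.segment
    have h₃ : l.segment 0 s ⊆ l := List.segment_subset
    have h₄ : l.segment p l.length ⊆ l := List.segment_subset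
    generalize l.segment 0 s = A at *
    generalize l.segment p l.length = B at *
    simp only [List.nodup_append', List.nodup_cons, List.disjoint_append_right, List.mem_append,
      List.disjoint_cons_right] at *
    grind [List.Disjoint]
  · intro v hv hv'
    simp only [List.mem_append, List.mem_cons, not_or] at hv'
    obtain ⟨i, hi, hiv⟩ := List.mem_iff_getElem.1 hv
    have hiv' : l[i]? = some v := by rw [List.getElem?_eq_getElem hi, hiv]
    refine List.mem_segment.2 ⟨i, ?_, ?_, hiv'⟩
    · by_contra h
      exact hv'.1 (List.mem_segment.2 ⟨i, by omega, by omega, hiv'⟩)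
    · by_contra h
      exact hv'.2.2.2.2 (List.mem_segment.2 ⟨i, by omega, by omega, hiv'⟩)

lemma IsFan.reroutes_segment_union (hF : G.IsFan l x K F) (hl : l.IsChain G.Adj) (hln : l.Nodup)
    (hx : x ∉ l) {s s' p q : ℕ} (hs : s ∈ K) (hs' : s' ∈ K) (hsp : s ≤ p) (hps : p < s')
    (hsq : s' ≤ q) {y z : V} (hy : l[p]? = some y) (hz : l[q]? = some z) {Q : List V}
    (hQ : (y :: (Q ++ [z])).IsChain G.Adj) (hQn : Q.Nodup) (hQl : List.Disjoint Q l) (hQx : x ∉ Q)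
    (hQF : List.Disjoint Q (F s)) (hQF' : List.Disjoint Q (F s')) :
    G.Reroutes l x {v | v ∈ l.segment s p ∨ v ∈ l.segment s' q} := by
  have hFn := hF.nodup s hs
  have hFl := hF.notMem s hs
  have hFn' := hF.nodup s' hs'
  have hFl' := hF.notMem s' hs'
  have hFF := hF.disjoint s hs s' hs' (by omega)
  have hs'l := hF.le_length s' hs'
  refine ⟨l.segment 0 s ++ (F s ++ (x :: ((F s').reverse ++ ((l.segment p s').reverse ++
    (Q ++ l.segment q l.length))))), ?_, ?_, by simp, ?_⟩
  · have hyseg : l.segment p s' ≠ [] :=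
      List.ne_nil_of_mem (List.mem_segment.2 ⟨p, le_rfl, hps, hy⟩)
    have hzseg : l.segment q l.length ≠ [] :=
      List.ne_nil_of_mem (List.mem_segment.2 ⟨q, le_rfl, (List.getElem?_eq_some_iff.1 hz).1, hz⟩)
    have hzhead : (l.segment q l.length).head? = some z := by
      obtain ⟨w, hw⟩ := Option.isSome_iff_exists.1 (List.isSome_head?.2 hzseg)
      rw [hw, ← hz, List.mem_head?_segment hw]
    have hyhead : (l.segment p s').head? = some y := by
      obtain ⟨w, hw⟩ := Option.isSome_iff_exists.1 (List.isSome_head?.2 hyseg)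
      rw [hw, ← hy, List.mem_head?_segment hw]
    have hrev : ∀ L : List V, L.IsChain G.Adj → L.reverse.IsChain G.Adj := by
      intro L hL
      rw [List.isChain_reverse]
      exact hL.imp fun _ _ h => h.symm
    have h₁ : (y :: (Q ++ l.segment q l.length)).IsChain G.Adj := by
      rw [← List.cons_append] at hQ ⊢
      rw [List.isChain_append] at hQ
      refine hQ.1.append hl.segment ?_
      rw [hzhead]
      simpa using hQ.2.2
    have h₂ : ((l.segment p s').reverse ++ (Q ++ l.segment q l.length)).IsChain G.Adj := by
      refine (hrev _ hl.segment).append h₁.tail ?_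
      rw [List.getLast?_reverse, hyhead]
      rintro _ ⟨⟩ w hw
      exact h₁.rel_head? hw
    have h₃ : (x :: ((F s').reverse ++ ((l.segment p s').reverse ++
        (Q ++ l.segment q l.length)))).IsChain G.Adj := by
      rw [← List.cons_append]
      have : x :: (F s').reverse = (F s' ++ [x]).reverse := by simp
      rw [this]
      refine (hrev _ (hF.isChain s' hs')).append h₂ fun v hv u hu => ?_
      rw [List.getLast?_reverse] at hv
      rw [List.head?_append_of_ne_nil _ (by simpa using hyseg), List.head?_reverse] at hu
      obtain ⟨h0, hu⟩ := List.mem_getLast?_segment hu hs'l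
      exact (hF.adj s' hs' h0 u hu v hv).symm
    have h₄ : (F s ++ (x :: ((F s').reverse ++ ((l.segment p s').reverse ++
        (Q ++ l.segment q l.length))))).IsChain G.Adj := by
      have := hF.isChain s hs
      rw [List.isChain_append] at this
      exact this.1.append h₃ (by simpa using this.2.2)
    refine hl.segment.append h₄ fun u hu v hv => ?_
    obtain ⟨hs0, hu⟩ := List.mem_getLast?_segment hu (hF.le_length s hs)
    refine hF.adj s hs hs0 u hu v ?_
    rw [List.head?_append] at hv ⊢
    simpa using hv
  · have hd₁ := hln.disjoint_segment (a := 0) (d := s') hsp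
    have hd₂ := hln.disjoint_segment (a := 0) (d := l.length) (hsp.trans (hps.le.trans hsq))
    have hd₃ := hln.disjoint_segment (a := p) (d := l.length) hsq
    have h₁ : (l.segment 0 s).Nodup := hln.segment
    have h₂ : (l.segment p s').Nodup := hln.segment
    have h₃ : (l.segment q l.length).Nodup := hln.segment
    have h₄ : l.segment 0 s ⊆ l := List.segment_subset
    have h₅ : l.segment p s' ⊆ l := List.segment_subset
    have h₆ : l.segment q l.length ⊆ l := List.segment_subset
    clear hQ hy hz
    generalize l.segment 0 s = A at *
    generalize l.segment p s' = B at *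
    generalize l.segment q l.length = C at *
    simp only [List.nodup_append', List.nodup_cons, List.disjoint_append_right, List.mem_append,
      List.disjoint_cons_right, List.nodup_reverse, List.mem_reverse] at *
    simp only [List.Disjoint, List.mem_reverse] at *
    and_intros <;> first | assumption | grind
  · intro v hv hv'
    simp only [List.mem_append, List.mem_cons, List.mem_reverse, not_or] at hv'
    obtain ⟨i, hi, hiv⟩ := List.mem_iff_getElem.1 hv
    have hiv' : l[i]? = some v := by rw [List.getElem?_eq_getElem hi, hiv]
    have mem : ∀ a b, a ≤ i → i < b → v ∈ l.segment a b := fun a b h₁ h₂ =>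
      List.mem_segment.2 ⟨i, h₁, h₂, hiv'⟩
    have n₁ : ¬ i < s := fun h => hv'.1 (mem _ _ (by omega) h)
    have n₂ : ¬ (p ≤ i ∧ i < s') := fun h => hv'.2.2.2.2.1 (mem _ _ h.1 h.2)
    have n₃ : ¬ q ≤ i := fun h => hv'.2.2.2.2.2.2 (mem _ _ h hi)
    by_cases hip : i < p
    · exact Or.inl (mem _ _ (by omega) hip)
    · exact Or.inr (mem _ _ (by omega) (by omega))

end SimpleGraph

namespace SimpleGraph

variable {G : SimpleGraph V} {P : Set V} {l : List V} {x : V} {K : Finset ℕ} {F : ℕ → List V}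

lemma Reachable.notMem_of_isolate {u v : V} (h : (G.isolate P).Reachable u v) (hu : u ∉ P) :
    v ∉ P := by
  obtain ⟨p⟩ := h.symm
  cases p with
  | nil => exact hu
  | cons hadj _ => exact hadj.2.1

lemma Reachable.exists_list_of_isolate {u v : V} (h : (G.isolate P).Reachable u v) (hu : u ∉ P) :
    ∃ L : List V, L.IsChain G.Adj ∧ L.Nodup ∧ L.head? = some u ∧ L.getLast? = some v ∧
      ∀ w ∈ L, (G.isolate P).Reachable u w ∧ w ∉ P := by
  classical
  obtain ⟨p, hp⟩ := h.exists_isPath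
  refine ⟨p.support, p.isChain_adj_support.imp fun _ _ h => h.1, hp.support_nodup, ?_, ?_, ?_⟩
  · rw [List.head?_eq_some_head p.support_ne_nil, p.head_support]
  · rw [List.getLast?_eq_some_getLast p.support_ne_nil, p.getLast_support]
  · intro w hw
    have hr : (G.isolate P).Reachable u w := ⟨p.takeUntil w hw⟩
    exact ⟨hr, hr.notMem_of_isolate hu⟩

lemma reachable_isolate_of_isChain (L : List V) (h : (L ++ [x]).IsChain G.Adj)
    (hL : ∀ v ∈ L ++ [x], v ∉ P) : ∀ v ∈ L ++ [x], (G.isolate P).Reachable v x := by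
  induction L with
  | nil =>
    intro v hv
    obtain rfl : v = x := by simpa using hv
    exact .refl _
  | cons a L ih =>
    rw [List.cons_append] at h hL ⊢
    have ih := ih h.of_cons fun v hv => hL v (by simp [hv])
    intro v hv
    obtain rfl | hv := List.mem_cons.1 hv
    · obtain ⟨b, hb⟩ : ∃ b, (L ++ [x]).head? = some b :=
        Option.isSome_iff_exists.1 (List.isSome_head?.2 (by simp))
      have hbm := List.mem_of_mem_head? hb
      exact (Adj.reachable (G := G.isolate P)
        ⟨h.rel_head? hb, hL v (by simp), hL b (by simp [hbm])⟩).trans (ih b hbm)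
    · exact ih v hv

lemma LinkedOff.exists_list {u v : V} (h : G.LinkedOff P u v) :
    ∃ Q : List V, (u :: (Q ++ [v])).IsChain G.Adj ∧ Q.Nodup ∧ (∀ w ∈ Q, w ∉ P) ∧
      ∀ w ∈ Q, ∃ s, s ∉ P ∧ G.Adj u s ∧ (G.isolate P).Reachable s w := by
  rcases h with h | ⟨s, t, hs, ht, hus, hst, htv⟩
  · exact ⟨[], by simpa using h, by simp, by simp, by simp⟩
  · obtain ⟨L, hL, hLn, hLs, hLt, hLP⟩ := hst.exists_list_of_isolate hs
    refine ⟨L, ?_, hLn, fun w hw => (hLP w hw).2, fun w hw => ⟨s, hs, hus, (hLP w hw).1⟩⟩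
    have hne : L ≠ [] := by rintro rfl; simp at hLs
    rw [List.isChain_cons, List.isChain_append]
    refine ⟨?_, hL, by simp, ?_⟩
    · rw [List.head?_append_of_ne_nil _ hne, hLs]
      simpa using hus
    · rw [hLt]
      simpa using htv

lemma IsChain.reverse {L : List V} (h : L.IsChain G.Adj) : L.reverse.IsChain G.Adj := by
  rw [List.isChain_reverse]
  exact h.imp fun _ _ h => h.symm

lemma IsFan.reroutes_tail (hF : G.IsFan l x K F) (hl : l.IsChain G.Adj) (hln : l.Nodup)
    (hx : x ∉ l) {s : ℕ} (hs : s ∈ K) : G.Reroutes l x {v | v ∈ l.segment s l.length} :=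
  hF.reroutes_segment hl hln hx hs (hF.le_length s hs) (Z := []) (by simp) (by simp) (by simp)
    (by simp) (by simp)

lemma IsFan.reroutes_segment_pred (hF : G.IsFan l x K F) (hl : l.IsChain G.Adj) (hln : l.Nodup)
    (hx : x ∉ l) {s s' : ℕ} (hs : s ∈ K) (hs' : s' ∈ K) (hss : s < s') :
    G.Reroutes l x {v | v ∈ l.segment s (s' - 1)} := by
  have hrev : x :: (F s').reverse = (F s' ++ [x]).reverse := by simp
  refine hF.reroutes_segment hl hln hx hs (by omega) (Z := (F s').reverse) ?_ ?_ ?_ ?_ ?_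
  · rw [hrev]
    exact IsChain.reverse (hF.isChain s' hs')
  · rw [hrev, List.nodup_reverse]
    exact hF.nodup s' hs'
  · intro v hv
    exact hF.notMem s' hs' v (List.mem_reverse.1 hv)
  · intro v hv
    exact hF.disjoint s' hs' s hs hss.ne' (List.mem_reverse.1 hv)
  · intro y hy v hv
    rw [hrev, List.getLast?_reverse] at hv
    exact (hF.adj s' hs' (by omega) y hy v hv).symm

/-- If `x` is linked to the entry of `l` at position `p` behind the foot `s`, either the segment
between them can be bypassed, or the foot can be moved to that position. -/
lemma IsFan.reroutes_or_exists_isFan_of_linkedOff (hF : G.IsFan l x K F) (hl : l.IsChain G.Adj)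
    (hln : l.Nodup) (hx : x ∉ l) {s p : ℕ} (hs : s ∈ K) (hsp : s ≤ p)
    (hK : ∀ t ∈ K, s < t → p + 1 < t) {y : V} (hy : l[p]? = some y)
    (hxy : G.LinkedOff {v | v ∈ l} x y) :
    G.Reroutes l x {v | v ∈ l.segment s p} ∨
      ∃ K' F', G.IsFan l x K' F' ∧ K'.card = K.card ∧ ∑ i ∈ K, i < ∑ i ∈ K', i := by
  classical
  obtain ⟨h, hhl, hhx, hhy⟩ : ∃ h, h ∉ {v | v ∈ l} ∧
      (G.isolate {v | v ∈ l}).Reachable h x ∧ G.Adj h y := by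
    rcases hxy with hxy | ⟨a, b, ha, hb, hxa, hab, hby⟩
    · exact ⟨x, hx, .refl _, hxy⟩
    · have : (G.isolate {v | v ∈ l}).Adj x a := ⟨hxa, hx, ha⟩
      exact ⟨b, hb, (this.reachable.trans hab).symm, hby⟩
  obtain ⟨L, hL, hLn, hLh, hLx, hLl⟩ := hhx.exists_list_of_isolate hhl
  replace hLl : ∀ w ∈ L, w ∉ l := fun w hw => (hLl w hw).2
  have hfind : (L.find? fun w => decide (∃ t ∈ K, w ∈ F t ++ [x])).isSome := by
    rw [List.find?_isSome]
    exact ⟨x, List.mem_of_mem_getLast? hLx, by simpa using ⟨0, hF.zero_mem⟩⟩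
  obtain ⟨w, hw⟩ := Option.isSome_iff_exists.1 hfind
  obtain ⟨hwR, l₁, l₂, rfl, hl₁⟩ := List.find?_eq_some_iff_append.1 hw
  simp only [decide_eq_true_eq, Bool.not_eq_true', decide_eq_false_iff_not] at hwR hl₁
  obtain ⟨hL₁, -⟩ := List.isChain_split.1 hL
  have hl₁F : ∀ t ∈ K, ∀ v ∈ F t, v ∉ l₁ := fun t ht v hv hv' =>
    hl₁ v hv' ⟨t, ht, by simp [hv]⟩
  have hl₁x : x ∉ l₁ := fun hx' => hl₁ x hx' ⟨0, hF.zero_mem, by simp⟩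
  have hwl : w ∉ l := hLl w (by simp)
  have hl₁l : ∀ v ∈ l₁, v ∉ l := fun v hv => hLl v (by simp [hv])
  have hl₁n : (l₁ ++ [w]).Nodup := hLn.sublist (by simp)
  have hhead : (l₁ ++ [w]).head? = some h := by
    rw [← hLh]; cases l₁ <;> simp
  clear hLn hL hLx hw hfind hLl hLh
  by_cases hwx : w = x
  · subst hwx
    left
    have hrev : w :: l₁.reverse = (l₁ ++ [w]).reverse := by simp
    refine hF.reroutes_segment hl hln hx hs hsp (Z := l₁.reverse) ?_ ?_ ?_ ?_ ?_
    · rw [hrev]; exact IsChain.reverse hL₁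
    · rw [hrev, List.nodup_reverse]; exact hl₁n
    · intro v hv; exact hl₁l v (List.mem_reverse.1 hv)
    · intro v hv hv'; exact hl₁F s hs v hv' (List.mem_reverse.1 hv)
    · intro y' hy' v hv
      rw [hrev, List.getLast?_reverse, hhead] at hv
      obtain rfl : h = v := by simpa using hv
      obtain rfl : y = y' := by simpa [hy] using hy'
      exact hhy
  obtain ⟨t, ht, hwt⟩ := hwR
  replace hwt : w ∈ F t := by simpa [hwx] using hwt
  obtain ⟨f₁, f₂, hft⟩ := List.append_of_mem hwt
  have hc := hF.isChain t ht
  have hn := hF.nodup t ht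
  have hFtl := hF.notMem t ht
  have hl₁t := hl₁F t ht
  rw [hft, List.append_assoc, List.cons_append] at hc hn
  obtain ⟨-, hc₂⟩ := List.isChain_split.1 hc
  have hnewc : (l₁ ++ w :: (f₂ ++ [x])).IsChain G.Adj := List.isChain_split.2 ⟨hL₁, hc₂⟩
  have hnewn : (l₁ ++ w :: (f₂ ++ [x])).Nodup := by
    rw [hft] at hl₁t
    simp only [List.nodup_append', List.nodup_cons, List.mem_append, List.mem_cons,
      List.Disjoint] at *
    grind
  have hnewhead : (l₁ ++ w :: (f₂ ++ [x])).head? = some h := by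
    rw [← hhead]; cases l₁ <;> simp
  have hnewF : ∀ v ∈ l₁ ++ w :: f₂, v ∈ l₁ ∨ v ∈ F t := by
    rw [hft]; intro v hv; simp only [List.mem_append, List.mem_cons] at *; tauto
  by_cases hts : t = s
  · right
    subst hts
    have ht0 : t ≠ 0 := by
      rintro rfl
      simp [hF.zero] at hwt
    have hpK : p + 1 ∉ K := fun hp => by have := hK _ hp (by omega); omega
    have hmem : ∀ i ∈ insert (p + 1) (K.erase t), i = p + 1 ∨ (i ∈ K ∧ i ≠ t ∧ i ≠ p + 1) := by
      intro i hi
      rw [Finset.mem_insert, Finset.mem_erase] at hi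
      rcases hi with hi | hi
      · exact Or.inl hi
      · exact Or.inr ⟨hi.2, hi.1, fun h => hpK (h ▸ hi.2)⟩
    refine ⟨insert (p + 1) (K.erase t), Function.update F (p + 1) (l₁ ++ w :: f₂), ?_, ?_, ?_⟩
    · constructor
      · simp [hF.zero_mem, ht0.symm]
      · simp [hF.zero]
      · intro i hi
        rcases hmem i hi with rfl | ⟨hi, -⟩
        · exact (List.getElem?_eq_some_iff.1 hy).1
        · exact hF.le_length i hi
      · intro i hi
        rcases hmem i hi with rfl | ⟨hi, -, hip⟩
        · simpa using hnewc
        · simpa [hip] using hF.isChain i hi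
      · intro i hi
        rcases hmem i hi with rfl | ⟨hi, -, hip⟩
        · simpa using hnewn
        · simpa [hip] using hF.nodup i hi
      · intro i hi
        rcases hmem i hi with rfl | ⟨hi, -, hip⟩
        · intro v hv
          rw [Function.update_self] at hv
          exact (hnewF v hv).elim (hl₁l v) (hFtl v)
        · simpa [hip] using hF.notMem i hi
      · have key : ∀ i ∈ K, i ≠ t → List.Disjoint (l₁ ++ w :: f₂) (F i) := by
          intro i hi hit v hv hv'
          exact (hnewF v hv).elim (hl₁F i hi v hv') (fun h => hF.disjoint t ht i hi hit.symm h hv')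
        intro i hi j hj hij
        rcases hmem i hi with rfl | ⟨hi, hit, hip⟩ <;> rcases hmem j hj with rfl | ⟨hj, hjt, hjp⟩
        · exact absurd rfl hij
        · simpa [hjp] using key j hj hjt
        · simpa only [Function.update_self, Function.update_of_ne hip] using (key i hi hit).symm
        · simpa [hip, hjp] using hF.disjoint i hi j hj hij
      · intro i hi
        rcases hmem i hi with rfl | ⟨hi, -, hip⟩
        · intro _ u hu v hv
          rw [Function.update_self, List.append_assoc, List.cons_append, hnewhead] at hv
          obtain rfl : h = v := by simpa using hv
          obtain rfl : y = u := by simpa [hy] using hu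
          exact hhy.symm
        · simpa [hip] using hF.adj i hi
    · rw [Finset.card_insert_of_notMem (by simp [hpK]), Finset.card_erase_add_one ht]
    · rw [Finset.sum_insert (by simp [hpK]), ← Finset.add_sum_erase K _ ht]
      omega
  · left
    have hrev : x :: (l₁ ++ w :: f₂).reverse = (l₁ ++ w :: (f₂ ++ [x])).reverse := by simp
    refine hF.reroutes_segment hl hln hx hs hsp (Z := (l₁ ++ w :: f₂).reverse) ?_ ?_ ?_ ?_ ?_
    · rw [hrev]; exact IsChain.reverse hnewc
    · rw [hrev, List.nodup_reverse]; exact hnewn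
    · intro v hv
      exact (hnewF v (List.mem_reverse.1 hv)).elim (hl₁l v) (hFtl v)
    · intro v hv hv'
      exact (hnewF v (List.mem_reverse.1 hv)).elim (hl₁F s hs v hv')
        (fun h => hF.disjoint t ht s hs hts h hv')
    · intro y' hy' v hv
      rw [hrev, List.getLast?_reverse, hnewhead] at hv
      obtain rfl : h = v := by simpa using hv
      obtain rfl : y = y' := by simpa [hy] using hy'
      exact hhy

lemma LinkedOff.of_reachable {s y : V} (hs : s ∉ P) (hy : G.Adj y s)
    (h : (G.isolate P).Reachable s x) : G.LinkedOff P x y := by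
  obtain ⟨p⟩ := h.symm
  cases p with
  | nil => exact Or.inl hy.symm
  | cons hadj q => exact Or.inr ⟨_, s, hadj.2.2, hs, hadj.1, ⟨q⟩, hy.symm⟩

lemma IsFan.reroutes_of_linkedOff (hF : G.IsFan l x K F) (hl : l.IsChain G.Adj) (hln : l.Nodup)
    (hx : x ∉ l) {s s' p q : ℕ} (hs : s ∈ K) (hs' : s' ∈ K) (hsp : s ≤ p) (hps : p < s')
    (hsq : s' ≤ q) {y z : V} (hy : l[p]? = some y) (hz : l[q]? = some z)
    (hyz : G.LinkedOff {v | v ∈ l} y z) (hxy : ¬ G.LinkedOff {v | v ∈ l} x y) :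
    G.Reroutes l x {v | v ∈ l.segment s p ∨ v ∈ l.segment s' q} := by
  obtain ⟨Q, hQ, hQn, hQl, hQr⟩ := hyz.exists_list
  have key : ∀ v ∈ Q, ¬ (G.isolate {v | v ∈ l}).Reachable v x := by
    intro v hv hvx
    obtain ⟨t, ht, hyt, htv⟩ := hQr v hv
    exact hxy (LinkedOff.of_reachable ht hyt (htv.trans hvx))
  have keyF : ∀ t ∈ K, List.Disjoint Q (F t) := by
    intro t ht v hv hv'
    refine key v hv (reachable_isolate_of_isChain (F t) (hF.isChain t ht) ?_ v (by simp [hv']))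
    intro u hu
    rw [List.mem_append, List.mem_singleton] at hu
    rcases hu with hu | rfl
    · exact hF.notMem t ht u hu
    · exact hx
  exact hF.reroutes_segment_union hl hln hx hs hs' hsp hps hsq hy hz hQ hQn
    (fun v hv => hQl v hv) (fun hxQ => key x hxQ (.refl _)) (keyF s hs) (keyF s' hs')

end SimpleGraph

namespace SimpleGraph

section Fan

variable [Finite V] {G : SimpleGraph V} {S W X : Set V} {l : List V} {x y : V} {k m : ℕ}
  {K : Finset ℕ} {F : ℕ → List V}

omit [Finite V] in
lemma Walk.IsPath.exists_mem_of_separates_isolate {B : Set V} {p : G.Walk x y} (hp : p.IsPath)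
    (hxy : x ≠ y) (hy : y ∈ B) (hX : (G.isolate {x}).Separates {a | G.Adj x a} B X) :
    ∃ v ∈ p.support, v ∈ X ∧ v ≠ x := by
  cases p with
  | nil => exact absurd rfl hxy
  | @cons _ a _ hadj q =>
    obtain ⟨-, hxq⟩ := (Walk.cons_isPath_iff _ _).1 hp
    have hq : ∀ e ∈ q.edges, e ∈ (G.isolate {x}).edgeSet := by
      intro e he
      induction e with
      | h u v =>
        refine ⟨q.adj_of_mem_edges he, ?_, ?_⟩
        · rintro rfl
          exact hxq (q.fst_mem_support_of_mem_edges he)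
        · rintro rfl
          exact hxq (q.snd_mem_support_of_mem_edges he)
    obtain ⟨v, hv, hvX⟩ := hX a hadj y hy (q.transfer _ hq)
    rw [Walk.support_transfer] at hv
    exact ⟨v, by simp [hv], hvX, fun h => hxq (h ▸ hv)⟩

lemma localConn_le_ncard_of_separates_isolate {B : Set V} (hxy : x ≠ y) (hy : y ∈ B) (hyX : y ∉ X)
    (hX : (G.isolate {x}).Separates {a | G.Adj x a} B X) : localConn G x y ≤ X.ncard := by
  classical
  have := Fintype.ofFinite V
  have : Finite (G.Path x y) := Finite.of_fintype _
  refine csSup_le ⟨0, ∅, by simp, by simp⟩ ?_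
  rintro _ ⟨P, hP, rfl⟩
  choose f hf hfX hfx using fun p : G.Path x y => p.2.exists_mem_of_separates_isolate hxy hy hX
  refine Set.ncard_le_ncard_of_injOn f (fun p _ => hfX p) fun p hp q hq hpq => ?_
  by_contra hne
  rcases hP hp hq hne (f p) (hf p) (hpq ▸ hf q) with h | h
  · exact hfx p h
  · exact hyX (h ▸ hfX p)

omit [Finite V] in
lemma Walk.exists_fan_path {a b : V} (p : (G.isolate {x}).Walk a b) (hp : p.IsPath)
    (ha : G.Adj x a) (hb : b ∈ l) :
    ∃ (s : ℕ) (w : V) (L : List V), l[s]? = some w ∧ w ∈ p.support ∧ L ⊆ p.support ∧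
      (w :: (L ++ [x])).IsChain G.Adj ∧ (L ++ [x]).Nodup ∧ ∀ v ∈ L, v ∉ l := by
  classical
  have hxp : x ∉ p.support := fun hx =>
    (Reachable.notMem_of_isolate ⟨p.takeUntil x hx⟩ (P := {x}) ha.ne') rfl
  have hfind : (p.support.find? fun w => decide (w ∈ l)).isSome := by
    rw [List.find?_isSome]
    exact ⟨b, p.end_mem_support, by simpa using hb⟩
  obtain ⟨w, hw⟩ := Option.isSome_iff_exists.1 hfind
  obtain ⟨hwl, l₁, l₂, hp', hl₁⟩ := List.find?_eq_some_iff_append.1 hw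
  simp only [decide_eq_true_eq, Bool.not_eq_true', decide_eq_false_iff_not] at hwl hl₁
  obtain ⟨s, hs⟩ := List.mem_iff_getElem?.1 hwl
  have hc : (x :: p.support).IsChain G.Adj := by
    refine List.isChain_cons.2 ⟨?_, p.isChain_adj_support.imp fun _ _ h => h.1⟩
    rw [List.head?_eq_some_head p.support_ne_nil, p.head_support]
    simpa using ha
  have hn : (x :: p.support).Nodup := List.nodup_cons.2 ⟨hxp, hp.support_nodup⟩
  rw [hp'] at hc hn hxp ⊢
  have hrev : w :: (l₁.reverse ++ [x]) = (x :: l₁ ++ [w]).reverse := by simp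
  refine ⟨s, w, l₁.reverse, hs, by simp, ?_, ?_, ?_, ?_⟩
  · intro v hv
    simp [List.mem_reverse.1 hv]
  · rw [hrev]
    exact IsChain.reverse (List.isChain_split.1 hc).1
  · have : (x :: l₁).Nodup := hn.sublist (by simp)
    simpa [and_comm, List.nodup_append'] using this
  · intro v hv
    exact hl₁ v (List.mem_reverse.1 hv)

lemma exists_isFan (hx : x ∉ l) (h : ∀ y ∈ S, x ≠ y → k ≤ localConn G x y) :
    ∃ K F, G.IsFan l x K F ∧ K.card = min k (S ∩ {v | v ∈ l}).ncard + 1 := by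
  classical
  obtain ⟨a, b, p, hp, hdisj⟩ := hasLinkage_of_forall_separates (G.isolate {x})
    (min k (S ∩ {v | v ∈ l}).ncard) {a | G.Adj x a} {v | v ∈ l} <| by
      intro X hX
      by_cases hSX : S ∩ {v | v ∈ l} ⊆ X
      · exact (min_le_right _ _).trans (Set.ncard_le_ncard hSX)
      · obtain ⟨y, ⟨hyS, hyl⟩, hyX⟩ := Set.not_subset.1 hSX
        have hxy : x ≠ y := fun h => hx (h ▸ hyl)
        exact (min_le_left _ _).trans
          ((h y hyS hxy).trans (localConn_le_ncard_of_separates_isolate hxy hyl hyX hX))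
  choose s w L hs hw hL hc hn hLl using fun i =>
    (p i).exists_fan_path (l := l) (hp i).2.2 (hp i).1 (hp i).2.1
  have hinj : Function.Injective fun i => s i + 1 := by
    intro i j hij
    have hij : s i = s j := by simpa using hij
    have : w i = w j := Option.some_injective _ (by rw [← hs, ← hs, hij])
    exact hdisj i j (w i) (hw i) (this ▸ hw j)
  have hmem : ∀ n ∈ insert 0 (Finset.univ.image fun i => s i + 1), n = 0 ∨ ∃ i, s i + 1 = n := by
    simp
  have hzero : Function.extend (fun i => s i + 1) L (fun _ => []) 0 = [] :=
    Function.extend_apply' _ _ _ (by simp)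
  have hsucc : ∀ i, Function.extend (fun i => s i + 1) L (fun _ => []) (s i + 1) = L i :=
    fun i => hinj.extend_apply _ _ i
  refine ⟨insert 0 (Finset.univ.image fun i => s i + 1),
    Function.extend (fun i => s i + 1) L (fun _ => []), ?_, ?_⟩
  · constructor
    · simp
    · exact hzero
    · intro n hn'
      obtain rfl | ⟨i, rfl⟩ := hmem n hn'
      · simp
      · exact (List.getElem?_eq_some_iff.1 (hs i)).1
    · intro n hn'
      obtain rfl | ⟨i, rfl⟩ := hmem n hn'
      · simp
      · rw [hsucc]
        exact (hc i).of_cons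
    · intro n hn'
      obtain rfl | ⟨i, rfl⟩ := hmem n hn'
      · simp
      · rw [hsucc]
        exact hn i
    · intro n hn'
      obtain rfl | ⟨i, rfl⟩ := hmem n hn'
      · simp
      · rw [hsucc]
        exact hLl i
    · intro n hn' n' hn'' hne
      obtain rfl | ⟨i, rfl⟩ := hmem n hn'
      · simp
      obtain rfl | ⟨j, rfl⟩ := hmem n' hn''
      · simp
      rw [hsucc, hsucc]
      intro v hv hv'
      exact hne (by rw [hdisj i j v (hL i hv) (hL j hv')])
    · intro n hn' hpos u hu v hv
      obtain rfl | ⟨i, rfl⟩ := hmem n hn'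
      · exact absurd hpos (lt_irrefl _)
      rw [hsucc] at hv
      obtain rfl : w i = u := by simpa [hs] using hu
      exact (hc i).rel_head? hv
  · rw [Finset.card_insert_of_notMem (by simp), Finset.card_image_of_injective _ hinj,
      Finset.card_univ, Fintype.card_fin]

omit [Finite V] in
lemma IsFan.exists_forall_sum_le (hF : G.IsFan l x K F) :
    ∃ K' F', G.IsFan l x K' F' ∧ K'.card = K.card ∧
      ∀ K'' F'', G.IsFan l x K'' F'' → K''.card = K'.card → ∑ i ∈ K'', i ≤ ∑ i ∈ K', i := by
  classical
  have hfin : {K' : Finset ℕ | K'.card = K.card ∧ ∃ F', G.IsFan l x K' F'}.Finite := by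
    refine (Finset.finite_toSet (Finset.range (l.length + 1)).powerset).subset ?_
    rintro K' ⟨-, F', hF'⟩
    simp only [Finset.coe_powerset, Set.mem_preimage, Set.mem_powerset_iff, Finset.coe_subset]
    intro s hs
    have := hF'.le_length s hs
    simp only [Finset.mem_range]
    omega
  obtain ⟨K', ⟨hc, F', hF'⟩, hmax⟩ :=
    hfin.exists_maximalFor (fun K' => ∑ i ∈ K', i) _ ⟨K, rfl, F, hF⟩
  refine ⟨K', F', hF', hc, fun K'' F'' hF'' hc' => ?_⟩
  exact (le_total _ _).elim id (hmax ⟨hc'.trans hc, F'', hF''⟩)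

lemma IsFan.add_card_le_indepNumOn (hF : G.IsFan l x K F) (hl : l.IsChain G.Adj) (hln : l.Nodup)
    (hx : x ∉ l) (hmax : ∀ K' F', G.IsFan l x K' F' → K'.card = K.card →
      ∑ i ∈ K', i ≤ ∑ i ∈ K, i)
    (hW : Disjoint W {v | v ∈ l}) (hxW : x ∉ W)
    (hT : ∀ T, G.Reroutes l x T → indepNumOn G W + 1 ≤ indepNumOn G (W ∪ (S ∩ T))) :
    K.card ≤ (S ∩ {v | v ∈ l}).ncard ∧ indepNumOn G (W ∪ {x}) + K.card ≤
      indepNumOn G (W ∪ ({x} ∪ (S ∩ {v | v ∈ l}))) := by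
  classical
  set A : ℕ → ℕ → Set V := fun s t => S ∩ {v | v ∈ l.segment s t} with hA
  have hAl : ∀ s t, A s t ⊆ S ∩ {v | v ∈ l} := fun s t v hv => ⟨hv.1, List.segment_subset hv.2⟩
  have hWA : ∀ s t, Disjoint W (A s t) := fun s t =>
    hW.mono_right ((hAl s t).trans Set.inter_subset_right)
  have hAA : ∀ s t s' t', t ≤ s' → Disjoint (A s t) (A s' t') := by
    intro s t s' t' h
    rw [Set.disjoint_left]
    exact fun v hv hv' => hln.disjoint_segment h hv.2 hv'.2
  have hτ : ∀ s ∈ K, ∃ t, indepNumOn G W + 1 ≤ indepNumOn G (W ∪ A s t) ∧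
      ∀ t' < t, indepNumOn G (W ∪ A s t') ≤ indepNumOn G W := by
    intro s hs
    have hex : ∃ t, indepNumOn G W + 1 ≤ indepNumOn G (W ∪ A s t) :=
      ⟨_, hT _ (hF.reroutes_tail hl hln hx hs)⟩
    exact ⟨Nat.find hex, Nat.find_spec hex, fun t' ht' => by
      have := Nat.find_min hex ht'
      omega⟩
  choose! τ hτ hτmin using hτ
  have hτgap : ∀ s ∈ K, ∀ s' ∈ K, s < s' → τ s + 1 ≤ s' := by
    intro s hs s' hs' hss
    by_contra h
    have h₁ := hτmin s hs (s' - 1) (by omega)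
    have h₂ := hT _ (hF.reroutes_segment_pred hl hln hx hs hs' hss)
    exact absurd (h₂.trans h₁) (by omega)
  have hxA : ∀ s ∈ K, ∀ p y, s ≤ p → p < τ s → l[p]? = some y →
      ¬ G.LinkedOff {v | v ∈ l} x y := by
    intro s hs p y hsp hp hy hxy
    have hK : ∀ t ∈ K, s < t → p + 1 < t := fun t ht hst => by
      have := hτgap s hs t ht hst
      omega
    rcases hF.reroutes_or_exists_isFan_of_linkedOff hl hln hx hs hsp hK hy hxy with
      h | ⟨K', F', hF', hc, hlt⟩
    · exact absurd ((hT _ h).trans (hτmin s hs p hp)) (by omega)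
    · exact absurd (hmax K' F' hF' hc) (by omega)
  have hlink : ∀ n, ∀ s ∈ K, ∀ s' ∈ K, s < s' → ∀ p q y z, p + q = n → s ≤ p → p < τ s →
      s' ≤ q → q < τ s' → l[p]? = some y → l[q]? = some z → ¬ G.LinkedOff {v | v ∈ l} y z := by
    intro n
    induction n using Nat.strong_induction_on with
    | _ n ih =>
      intro s hs s' hs' hss p q y z hn hsp hp hsq hq hy hz hyz
      have hgap := hτgap s hs s' hs' hss
      have h₁ := hT _ (hF.reroutes_of_linkedOff hl hln hx hs hs' hsp (by omega) hsq hy hz hyz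
        (hxA s hs p y hsp hp hy))
      have h₂ := indepNumOn_union_add_of_not_linkedOff (G := G) hW (hWA s p) (hWA s' q)
        (hAA s p s' q (by omega)) <| by
          rintro u ⟨-, hu⟩ v ⟨-, hv⟩
          obtain ⟨i, hsi, hip, hi⟩ := List.mem_segment.1 hu
          obtain ⟨j, hsj, hjq, hj⟩ := List.mem_segment.1 hv
          exact ih (i + j) (by omega) s hs s' hs' hss i j u v rfl hsi (by omega) hsj (by omega)
            hi hj
      have h₃ := hτmin s hs p hp
      have h₄ := hτmin s' hs' q hq
      have h₅ : S ∩ {v | v ∈ l.segment s p ∨ v ∈ l.segment s' q} = A s p ∪ A s' q :=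
        Set.inter_union_distrib_left _ _ _
      rw [h₅] at h₁
      omega
  have hlink' : ∀ s ∈ K, ∀ s' ∈ K, s < s' → ∀ u ∈ A s (τ s), ∀ v ∈ A s' (τ s'),
      ¬ G.LinkedOff {v | v ∈ l} u v := by
    rintro s hs s' hs' hss u ⟨-, hu⟩ v ⟨-, hv⟩
    obtain ⟨i, hsi, hip, hi⟩ := List.mem_segment.1 hu
    obtain ⟨j, hsj, hjq, hj⟩ := List.mem_segment.1 hv
    exact hlink _ s hs s' hs' hss i j u v rfl hsi hip hsj hjq hi hj
  have hdisj : (K : Set ℕ).Pairwise fun s s' => Disjoint (A s (τ s)) (A s' (τ s')) := by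
    intro s hs s' hs' hne
    rcases lt_or_gt_of_ne hne with h | h
    · exact hAA _ _ _ _ (by have := hτgap s hs s' hs' h; omega)
    · exact (hAA _ _ _ _ (by have := hτgap s' hs' s hs h; omega)).symm
  have hsum := add_card_le_indepNumOn_iUnion (G := G) K (fun s => A s (τ s)) hW
    (fun s _ => hWA _ _) hdisj (by
      intro s hs s' hs' hne u hu v hv huv
      rcases lt_or_gt_of_ne hne with h | h
      · exact hlink' s hs s' hs' h u hu v hv huv
      · exact hlink' s' hs' s hs h v hv u hu huv.symm) (fun s hs => hτ s hs)
  have hsub : ⋃ s ∈ K, A s (τ s) ⊆ S ∩ {v | v ∈ l} := Set.iUnion₂_subset fun s _ => hAl _ _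
  constructor
  · have hne : ∀ s ∈ K, (A s (τ s)).Nonempty := by
      intro s hs
      rw [Set.nonempty_iff_ne_empty]
      intro h
      have := hτ s hs
      rw [h, Set.union_empty] at this
      omega
    have : Nonempty V := ⟨x⟩
    choose! f hf using hne
    rw [← Set.ncard_coe_finset]
    refine Set.ncard_le_ncard_of_injOn f (fun s hs => hAl _ _ (hf s hs)) ?_
    intro s hs s' hs' hff
    by_contra hne
    exact Set.disjoint_left.1 (hdisj hs hs' hne) (hf s hs) (hff ▸ hf s' hs')
  · have h₁ := indepNumOn_union_add_of_not_linkedOff (G := G) (X := {x})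
      (Y := ⋃ s ∈ K, A s (τ s)) hW (by simpa using hxW)
      (hW.mono_right (hsub.trans Set.inter_subset_right))
      (by
        rw [Set.disjoint_singleton_left]
        exact fun h => hx (hsub h).2)
      (by
        rintro _ rfl v hv
        simp only [Set.mem_iUnion] at hv
        obtain ⟨s, hs, -, hv⟩ := hv
        obtain ⟨i, hsi, hi, hv⟩ := List.mem_segment.1 hv
        exact hxA s hs i v hsi hi hv)
    have h₂ : indepNumOn G (W ∪ ({x} ∪ ⋃ s ∈ K, A s (τ s))) ≤
        indepNumOn G (W ∪ ({x} ∪ (S ∩ {v | v ∈ l}))) :=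
      indepNumOn_mono (Set.union_subset_union_right _ (Set.union_subset_union_right _ hsub))
    omega

theorem exists_list_indepNumOn_sdiff_le (G : SimpleGraph V) (k : ℕ) (S : Set V)
    (hS : ∀ x ∈ S, ∀ y ∈ S, x ≠ y → k ≤ localConn G x y) :
    ∃ l : List V, l.IsChain G.Adj ∧ l.Nodup ∧
      indepNumOn G (S \ {v | v ∈ l}) ≤ indepNumOn G S - (k + 1) := by
  induction S, S.toFinite using Set.Finite.induction_on with
  | empty => exact ⟨[], by simp, by simp, by simp [indepNumOn_empty]⟩
  | @insert x S hxS _ ih =>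
    by_contra! hno
    obtain ⟨l, hl, hln, hle⟩ := ih fun y hy z hz => hS y (by simp [hy]) z (by simp [hz])
    have hmono : indepNumOn G S ≤ indepNumOn G (insert x S) :=
      indepNumOn_mono (Set.subset_insert _ _)
    have hx : x ∉ l := by
      intro hx
      have := hno l hl hln
      rw [Set.insert_sdiff_of_mem _ (show x ∈ {v | v ∈ l} from hx)] at this
      omega
    set W := S \ {v | v ∈ l} with hW
    have hWx : W ∪ {x} = insert x S \ {v | v ∈ l} := by
      rw [Set.insert_sdiff_of_notMem _ (show x ∉ {v | v ∈ l} from hx), Set.union_singleton]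
    have hWx' : indepNumOn G (insert x S) - (k + 1) + 1 ≤ indepNumOn G (W ∪ {x}) := by
      rw [hWx]
      exact hno l hl hln
    have hins := indepNumOn_insert_le (G := G) (S := W) x
    rw [← Set.union_singleton] at hins
    obtain ⟨K₀, F₀, hF₀, hc₀⟩ := exists_isFan (G := G) (S := S) (k := k) hx
      fun y hy hxy => hS x (by simp) y (by simp [hy]) hxy
    obtain ⟨K, F, hF, hc, hmax⟩ := hF₀.exists_forall_sum_le
    obtain ⟨h₁, h₂⟩ := hF.add_card_le_indepNumOn (S := S) (W := W) hl hln hx hmax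
      Set.disjoint_sdiff_left (fun h => hxS h.1) <| by
        rintro T ⟨l', hl', hln', hx', hT⟩
        have h₁ := hno l' hl' hln'
        have h₂ : insert x S \ {v | v ∈ l'} ⊆ W ∪ (S ∩ T) := by
          rintro v ⟨hv | hv, hvl'⟩
          · exact absurd (hv ▸ hx') hvl'
          · by_cases hvl : v ∈ l
            · exact Or.inr ⟨hv, hT v hvl hvl'⟩
            · exact Or.inl ⟨hv, hvl⟩
        have h₃ := indepNumOn_mono (G := G) h₂
        omega
    have h₃ : indepNumOn G (W ∪ ({x} ∪ (S ∩ {v | v ∈ l}))) ≤ indepNumOn G (insert x S) := by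
      apply indepNumOn_mono
      rintro v (hv | hv | hv)
      exacts [Or.inr hv.1, Or.inl hv, Or.inr hv.1]
    omega

end Fan

end SimpleGraph

/-- Either all vertices of `S` are covered by one path of `G`, or there is a path `P`
with `α_G(S - V(P)) ≤ α_G(S) - κ_G(S) - 1`. -/
theorem stmt_2 [Fintype V] (G : SimpleGraph V) (hG : G.Connected) (S : Set V) :
    (∃ (u v : V) (p : G.Walk u v), p.IsPath ∧ S ⊆ {x | x ∈ p.support}) ∨
    (∃ (u v : V) (p : G.Walk u v), p.IsPath ∧
      (indepNumOn G (S \ {x | x ∈ p.support}) : ℕ∞) + setConn G S + 1 ≤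
        (indepNumOn G S : ℕ∞)) := by
  have hle : ∀ x ∈ S, ∀ y ∈ S, x ≠ y → setConn G S ≤ localConn G x y := fun x hx y hy hxy =>
    iInf₂_le_of_le x hx (iInf₂_le_of_le y hy (iInf_le _ hxy))
  by_cases htop : setConn G S = ⊤
  · left
    have hS : S.Subsingleton := by
      intro x hx y hy
      by_contra hxy
      have := hle x hx y hy hxy
      simp [htop] at this
    obtain ⟨u, hu⟩ : ∃ u, S ⊆ {u} := by
      rcases hS.eq_empty_or_singleton with rfl | ⟨u, rfl⟩
      · exact ⟨hG.nonempty.some, Set.empty_subset _⟩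
      · exact ⟨u, subset_rfl⟩
    exact ⟨u, u, Walk.nil, Walk.IsPath.nil, by simpa using hu⟩
  obtain ⟨k, hk⟩ := ENat.ne_top_iff_exists.1 htop
  obtain ⟨l, hl, hln, hlS⟩ := exists_list_indepNumOn_sdiff_le G k S fun x hx y hy hxy => by
    have := hle x hx y hy hxy
    rw [← hk] at this
    exact_mod_cast this
  obtain ⟨u, v, p, hp, hlp⟩ : ∃ (u v : V) (p : G.Walk u v), p.IsPath ∧ l ⊆ p.support := by
    by_cases hne : l = []
    · subst hne
      have u := hG.nonempty.some
      exact ⟨u, u, Walk.nil, Walk.IsPath.nil, by simp⟩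
    · refine ⟨_, _, Walk.ofSupport l hne hl, ?_, by simp⟩
      rw [Walk.isPath_def, Walk.support_ofSupport]
      exact hln
  have hpS : indepNumOn G (S \ {x | x ∈ p.support}) ≤ indepNumOn G S - (k + 1) :=
    (indepNumOn_mono (Set.sdiff_subset_sdiff_right hlp)).trans hlS
  by_cases hα : k + 1 ≤ indepNumOn G S
  · refine Or.inr ⟨u, v, p, hp, ?_⟩
    rw [← hk]
    norm_cast
    omega
  · refine Or.inl ⟨u, v, p, hp, ?_⟩
    exact Set.sdiff_eq_empty.1 (eq_empty_of_indepNumOn_eq_zero (G := G) (by omega))
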